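/- Let D be a pseudo-distribution on {0,1}^n of degree at least 2t, let S ⊆ [n] with Ẽ_D[X_T] = 0 for all T ⊆ S with t ≤ |T| ≤ 2t and Ẽ_D[X_T · x_i] = 0 for all T ⊆ S with |T| ≥ t and i ∈ [n]. Fix U ⊆ S and i ∈ [n]. If Ẽ_D[rd(f_{S,U})] = 0 then Ẽ_D[x_i · rd(f_{S,U})] = 0; and if Ẽ_D[rd(f_{S,U})] > 0 then the ratio y_i^U = Ẽ_D[x_i · rd(f_{S,U})] / Ẽ_D[rd(f_{S,U})] satisfies 0 ≤ y_i^U ≤ 1. -/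

import Mathlib

/-- The point of `{0,1}` encoded by a boolean. -/
def b01 (b : Bool) : ℝ := if b then 1 else 0

/-- Pseudo-expectation of `f` with respect to `D` on `{0,1}^n`. -/
def PE {n : ℕ} (D f : (Fin n → Bool) → ℝ) : ℝ := ∑ x, D x * f x

/-- The monomial `X_T(x) = ∏_{i ∈ T} x_i` on `{0,1}^n`. -/
def XS {n : ℕ} (T : Finset (Fin n)) (x : Fin n → Bool) : ℝ := ∏ i ∈ T, b01 (x i)

/-- `f : {0,1}^n → ℝ` is a (multilinear) polynomial of degree at most `d`. -/
def DegLE {n : ℕ} (d : ℕ) (f : (Fin n → Bool) → ℝ) : Prop :=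
  ∃ c : Finset (Fin n) → ℝ, (∀ T : Finset (Fin n), d < T.card → c T = 0) ∧
    ∀ x, f x = ∑ T : Finset (Fin n), c T * XS T x

/-- `f_{S,U}` viewed as a function on `{0,1}^n`: the indicator that the set of
1-coordinates of `x` inside `S` is exactly `U`. -/
def indF {n : ℕ} (S U : Finset (Fin n)) (x : Fin n → Bool) : ℝ :=
  if S.filter (fun i => x i = true) = U then 1 else 0

/-- `rd`: the truncation of the multilinear polynomial with coefficients `c`
to monomials of degree strictly less than `t`. -/
def rd {n : ℕ} (t : ℕ) (c : Finset (Fin n) → ℝ) (x : Fin n → Bool) : ℝ :=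
  ∑ T ∈ Finset.univ.filter (fun T : Finset (Fin n) => T.card < t), c T * XS T x

/-- The multilinear polynomial with coefficients `c`. -/
def multilinear {n : ℕ} (c : Finset (Fin n) → ℝ) (x : Fin n → Bool) : ℝ :=
  ∑ T : Finset (Fin n), c T * XS T x

lemma b01_mul_self (b : Bool) : b01 b * b01 b = b01 b := by
  cases b <;> simp [b01]

lemma XS_eq_ite {n : ℕ} (T : Finset (Fin n)) (x : Fin n → Bool) :
    XS T x = if ∀ i ∈ T, x i = true then 1 else 0 := by
  simp only [XS, b01, Finset.prod_ite_zero, Finset.prod_const_one]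

lemma XS_mul_XS {n : ℕ} (A B : Finset (Fin n)) (x : Fin n → Bool) :
    XS A x * XS B x = XS (A ∪ B) x := by
  simp only [XS_eq_ite, Finset.mem_union, or_imp, forall_and, ite_and, ite_mul, one_mul, zero_mul]

lemma b01_mul_XS {n : ℕ} (i : Fin n) (T : Finset (Fin n)) (x : Fin n → Bool) :
    b01 (x i) * XS T x = XS (insert i T) x := by
  rw [Finset.insert_eq, ← XS_mul_XS]
  simp [XS]

lemma XS_mul_b01_of_mem {n : ℕ} {i : Fin n} {T : Finset (Fin n)} (hi : i ∈ T)
    (x : Fin n → Bool) : XS T x * b01 (x i) = XS T x := by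
  rw [mul_comm, b01_mul_XS, Finset.insert_eq_of_mem hi]

lemma PE_sum {n : ℕ} {ι : Type*} (D : (Fin n → Bool) → ℝ) (s : Finset ι) (a : ι → ℝ)
    (f : ι → (Fin n → Bool) → ℝ) :
    PE D (fun x => ∑ j ∈ s, a j * f j x) = ∑ j ∈ s, a j * PE D (f j) := by
  simp only [PE, Finset.mul_sum]
  rw [Finset.sum_comm]
  exact Finset.sum_congr rfl fun j _ => Finset.sum_congr rfl fun x _ => by ring

lemma DegLE.sum {n d : ℕ} {ι : Type*} (s : Finset ι) (a : ι → ℝ)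
    {f : ι → (Fin n → Bool) → ℝ} (hf : ∀ j ∈ s, DegLE d (f j)) :
    DegLE d (fun x => ∑ j ∈ s, a j * f j x) := by
  choose! c hc hfc using hf
  refine ⟨fun T => ∑ j ∈ s, a j * c j T, fun T hT => ?_, fun x => ?_⟩
  · exact Finset.sum_eq_zero fun j hj => by rw [hc j hj T hT, mul_zero]
  · simp only [Finset.sum_mul]
    rw [Finset.sum_comm]
    refine Finset.sum_congr rfl fun j hj => ?_
    rw [hfc j hj x, Finset.mul_sum]
    exact Finset.sum_congr rfl fun T _ => by ring

lemma DegLE.sub {n d : ℕ} {f g : (Fin n → Bool) → ℝ} (hf : DegLE d f) (hg : DegLE d g) :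
    DegLE d (fun x => f x - g x) := by
  obtain ⟨c, hc, hfc⟩ := hf
  obtain ⟨e, he, hge⟩ := hg
  refine ⟨fun T => c T - e T, fun T hT => by simp [hc T hT, he T hT], fun x => ?_⟩
  simp only [hfc, hge, sub_mul, Finset.sum_sub_distrib]

lemma degLE_XS {n d : ℕ} {T : Finset (Fin n)} (hT : T.card ≤ d) : DegLE d (XS T) := by
  refine ⟨fun A => if A = T then 1 else 0, fun A hA => if_neg ?_, fun x => ?_⟩
  · rintro rfl
    omega
  · simp

lemma degLE_rd {n : ℕ} (t : ℕ) (c : Finset (Fin n) → ℝ) : DegLE t (rd t c) :=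
  DegLE.sum _ c fun _ hT => degLE_XS (Finset.mem_filter.1 hT).2.le

lemma degLE_b01_mul_rd {n : ℕ} (t : ℕ) (c : Finset (Fin n) → ℝ) (i : Fin n) :
    DegLE t (fun x => b01 (x i) * rd t c x) := by
  have h : (fun x => b01 (x i) * rd t c x) = fun x =>
      ∑ T ∈ Finset.univ.filter (fun T : Finset (Fin n) => T.card < t),
        c T * XS (insert i T) x := by
    funext x
    rw [rd, Finset.mul_sum]
    exact Finset.sum_congr rfl fun T _ => by rw [← b01_mul_XS]; ring
  rw [h]
  exact DegLE.sum _ c fun T hT =>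
    degLE_XS ((Finset.card_insert_le i T).trans (Finset.mem_filter.1 hT).2)

/-- The coefficients of a multilinear polynomial which only depends on the coordinates in `S`
are supported on subsets of `S`. -/
lemma coeff_eq_zero_of_not_subset {n : ℕ} {S : Finset (Fin n)} {c : Finset (Fin n) → ℝ}
    (hc : ∀ x y : Fin n → Bool, (∀ i ∈ S, x i = y i) → multilinear c x = multilinear c y)
    (T : Finset (Fin n)) (hT : ¬ T ⊆ S) : c T = 0 := by
  have heval : ∀ A : Finset (Fin n),
      multilinear c (fun i => decide (i ∈ A)) = ∑ B ∈ A.powerset, c B := by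
    intro A
    simp only [multilinear, XS_eq_ite, decide_eq_true_eq, mul_ite, mul_one, mul_zero]
    rw [← Finset.sum_filter]
    refine Finset.sum_congr ?_ fun _ _ => rfl
    ext B
    simp [Finset.subset_iff]
  induction T using Finset.strongInduction with
  | H T ih =>
    have h := hc (fun i => decide (i ∈ T)) (fun i => decide (i ∈ T ∩ S)) (by
      intro i hi
      simp [hi])
    rw [heval, heval, ← Finset.sum_sdiff (Finset.powerset_mono.2 Finset.inter_subset_left),
      add_eq_right, Finset.sum_eq_single T] at h
    · exact h
    · intro B hB hBT
      simp only [Finset.mem_sdiff, Finset.mem_powerset, Finset.subset_inter_iff] at hB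
      exact ih B (hB.1.ssubset_of_ne hBT) fun hBS => hB.2 ⟨hB.1, hBS⟩
    · intro hmem
      refine absurd ?_ hmem
      simp only [Finset.mem_sdiff, Finset.mem_powerset, Finset.subset_inter_iff]
      exact ⟨subset_rfl, fun hTS => hT hTS.2⟩

/-- If the moments of `D` of order at least `t` inside `S` vanish, then so does the
pseudo-expectation of every element of the ideal spanned by the corresponding monomials. -/
lemma PE_multilinear_mul_multilinear_eq_zero {n t : ℕ} {D : (Fin n → Bool) → ℝ}
    {S : Finset (Fin n)} (hD : ∀ T ⊆ S, t ≤ T.card → PE D (XS T) = 0)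
    {a b : Finset (Fin n) → ℝ} (haS : ∀ T, ¬ T ⊆ S → a T = 0) (hat : ∀ T, T.card < t → a T = 0)
    (hb : ∀ T, ¬ T ⊆ S → b T = 0) :
    PE D (fun x => multilinear a x * multilinear b x) = 0 := by
  have h : (fun x => multilinear a x * multilinear b x) = fun x =>
      ∑ p : Finset (Fin n) × Finset (Fin n), (a p.1 * b p.2) * XS (p.1 ∪ p.2) x := by
    funext x
    simp only [multilinear, Finset.sum_mul_sum, Fintype.sum_prod_type, ← XS_mul_XS]
    exact Finset.sum_congr rfl fun A _ => Finset.sum_congr rfl fun B _ => by ring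
  rw [h, PE_sum]
  refine Finset.sum_eq_zero fun p _ => ?_
  by_cases h1 : p.1 ⊆ S
  · by_cases h2 : p.2 ⊆ S
    · by_cases h3 : p.1.card < t
      · rw [hat _ h3, zero_mul, zero_mul]
      · rw [hD _ (Finset.union_subset h1 h2)
          ((not_lt.1 h3).trans (Finset.card_le_card Finset.subset_union_left)), mul_zero]
    · rw [hb _ h2, mul_zero, zero_mul]
  · rw [haS _ h1, zero_mul, zero_mul]

/-- Truncations of idempotents behave like idempotents under a pseudo-expectation whose
moments of order at least `t` inside `S` vanish. -/
lemma PE_rd_mul_rd {n t : ℕ} {D : (Fin n → Bool) → ℝ} {S : Finset (Fin n)}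
    (hD : ∀ T ⊆ S, t ≤ T.card → PE D (XS T) = 0) {c : Finset (Fin n) → ℝ}
    (hc : ∀ T, ¬ T ⊆ S → c T = 0)
    (hidem : ∀ x, multilinear c x * multilinear c x = multilinear c x) :
    PE D (fun x => rd t c x * rd t c x) = PE D (rd t c) := by
  let a : Finset (Fin n) → ℝ := fun T => if T.card < t then 0 else c T
  let b : Finset (Fin n) → ℝ := fun T =>
    (if T = ∅ then 1 else 0) - c T - (if T.card < t then c T else 0)
  have hrd : ∀ x, rd t c x = ∑ T : Finset (Fin n), (if T.card < t then c T else 0) * XS T x := by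
    intro x
    simp only [rd, Finset.sum_filter, ite_mul, zero_mul]
  have ha : ∀ x, multilinear a x = multilinear c x - rd t c x := by
    intro x
    rw [hrd, multilinear, multilinear, ← Finset.sum_sub_distrib]
    refine Finset.sum_congr rfl fun T _ => ?_
    by_cases hT : T.card < t <;> simp [a, hT]
  have hb : ∀ x, multilinear b x = 1 - multilinear c x - rd t c x := by
    intro x
    have h1 : (1 : ℝ) = ∑ T : Finset (Fin n), (if T = ∅ then 1 else 0) * XS T x := by
      simp [XS]
    rw [hrd, h1, multilinear, multilinear, ← Finset.sum_sub_distrib, ← Finset.sum_sub_distrib]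
    exact Finset.sum_congr rfl fun T _ => by simp only [b]; ring
  have hzero := PE_multilinear_mul_multilinear_eq_zero hD (a := a) (b := b)
    (fun T hT => by simp [a, hc T hT]) (fun T hT => by simp [a, hT])
    (fun T hT => by
      have hne : T ≠ ∅ := by
        rintro rfl
        exact hT (Finset.empty_subset S)
      simp [b, hc T hT, hne])
  rw [← sub_eq_zero, ← hzero]
  simp only [PE]
  rw [← Finset.sum_sub_distrib]
  refine Finset.sum_congr rfl fun x _ => ?_
  rw [ha, hb]
  linear_combination D x * hidem x

/-- under the vanishing-moment hypotheses, the "conditional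
expectation" `y_i^U = Ẽ_D[x_i · rd(f_{S,U})] / Ẽ_D[rd(f_{S,U})]` is well
behaved: if the denominator vanishes so does the numerator, and otherwise
`0 ≤ y_i^U ≤ 1`. -/
theorem conditional_expectation_bounds (n t : ℕ) (D : (Fin n → Bool) → ℝ)
    (hsum : ∑ x, D x = 1)
    (hdeg : ∀ f : (Fin n → Bool) → ℝ, DegLE t f → 0 ≤ PE D (fun x => f x * f x))
    (S : Finset (Fin n))
    (hXT : ∀ T : Finset (Fin n), T ⊆ S → t ≤ T.card → T.card ≤ 2 * t →
      PE D (XS T) = 0)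
    (hXTi : ∀ T : Finset (Fin n), T ⊆ S → t ≤ T.card → ∀ i : Fin n,
      PE D (fun x => XS T x * b01 (x i)) = 0)
    (coeff : Finset (Fin n) → Finset (Fin n) → ℝ)
    (hcoeff : ∀ (U : Finset (Fin n)) (x : Fin n → Bool),
      indF S U x = ∑ T : Finset (Fin n), coeff U T * XS T x)
    (U : Finset (Fin n)) (hU : U ⊆ S) (i : Fin n) :
    (PE D (rd t (coeff U)) = 0 →
      PE D (fun x => b01 (x i) * rd t (coeff U) x) = 0) ∧
    (0 < PE D (rd t (coeff U)) →
      0 ≤ PE D (fun x => b01 (x i) * rd t (coeff U) x) / PE D (rd t (coeff U)) ∧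
      PE D (fun x => b01 (x i) * rd t (coeff U) x) / PE D (rd t (coeff U)) ≤ 1) := by
  have hsupp : ∀ T, ¬ T ⊆ S → coeff U T = 0 := by
    refine coeff_eq_zero_of_not_subset fun x y hxy => ?_
    rw [multilinear, multilinear, ← hcoeff, ← hcoeff, indF, indF,
      Finset.filter_congr fun j hj => by rw [hxy j hj]]
  have hidem : ∀ x, multilinear (coeff U) x * multilinear (coeff U) x =
      multilinear (coeff U) x := by
    intro x
    rw [multilinear, ← hcoeff, indF]
    split_ifs <;> simp
  have hmom : ∀ T ⊆ S, t ≤ T.card → PE D (XS T) = 0 := by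
    intro T hTS hT
    obtain rfl | ⟨j, hj⟩ := T.eq_empty_or_nonempty
    · exact hXT ∅ hTS hT (by simp)
    · rw [← hXTi T hTS hT j]
      simp only [XS_mul_b01_of_mem hj]
  have hmom₁ : ∀ T ⊆ S, t ≤ T.card → PE (fun x => D x * b01 (x i)) (XS T) = 0 := by
    intro T hTS hT
    rw [← hXTi T hTS hT i]
    exact Finset.sum_congr rfl fun x _ => by ring
  have hmom₀ : ∀ T ⊆ S, t ≤ T.card → PE (fun x => D x * (1 - b01 (x i))) (XS T) = 0 := by
    intro T hTS hT
    rw [← sub_zero (0 : ℝ)]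
    nth_rewrite 1 [← hmom T hTS hT]
    rw [← hXTi T hTS hT i]
    simp only [PE]
    rw [← Finset.sum_sub_distrib]
    exact Finset.sum_congr rfl fun x _ => by ring
  have hnonneg : 0 ≤ PE D (fun x => b01 (x i) * rd t (coeff U) x) := by
    have h := hdeg _ (degLE_b01_mul_rd t (coeff U) i)
    have h' := PE_rd_mul_rd hmom₁ hsupp hidem
    simp only [PE] at h h' ⊢
    calc _ ≤ _ := h
      _ = _ := Finset.sum_congr rfl fun x _ => by
        linear_combination D x * rd t (coeff U) x ^ 2 * b01_mul_self (x i)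
      _ = _ := h'
      _ = _ := Finset.sum_congr rfl fun x _ => by ring
  have hle : PE D (fun x => b01 (x i) * rd t (coeff U) x) ≤ PE D (rd t (coeff U)) := by
    have h := hdeg _ ((degLE_rd t (coeff U)).sub (degLE_b01_mul_rd t (coeff U) i))
    have h' := PE_rd_mul_rd hmom₀ hsupp hidem
    simp only [PE] at h h' ⊢
    rw [← sub_nonneg, ← Finset.sum_sub_distrib]
    calc _ ≤ _ := h
      _ = _ := Finset.sum_congr rfl fun x _ => by
        linear_combination D x * rd t (coeff U) x ^ 2 * b01_mul_self (x i)
      _ = _ := h'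
      _ = _ := Finset.sum_congr rfl fun x _ => by ring
  exact ⟨fun h => le_antisymm (hle.trans_eq h) hnonneg,
    fun h => ⟨div_nonneg hnonneg h.le, (div_le_one h).2 hle⟩⟩
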